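/- arXiv:1009.0015 — 3 statements merged into one kernel-verified Lean document; each statement's English description precedes it below -/
import Mathlib

section
/- Let Φ4 : Fin 2 → Fin 2 → Fin 2 → Fin 2 → ℝ satisfy Φ4 i j k l = −Φ4 j i k l and Φ4 i j k l = −Φ4 i j l k for all indices (antisymmetry in each index pair). Define ΦS i k := −(1/2) * ∑ j, Φ4 i j k j and φ := −(1/2) * ∑ i j, Φ4 i j i j. Then ΦS i k = (1/2) * φ * δ i k for all i, k. (This is the 4-dimensional identity Φ^S_{ij} = (1/2)Φδ_{ij}, which makes the obstruction term ρ²(Φ^S_{ij} − (1/(d−2))Φδ_{ij}) vanish identically when d = 4.) -/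
/-- Kronecker delta on `Fin 2`. -/
def δ (i j : Fin 2) : ℝ := if i = j then 1 else 0

/-- In n = 2 (spacetime dimension d = 4), for `Φ4` antisymmetric in
each index pair, the symmetric trace `Φ^S_{ik} = −(1/2)∑_j Φ4_{ijkj}` is pure trace:
`Φ^S_{ik} = (1/2) φ δ_{ik}` where `φ = −(1/2)∑_{ij} Φ4_{ijij}`. -/
theorem PhiS_pure_trace_dim4
    (Φ4 : Fin 2 → Fin 2 → Fin 2 → Fin 2 → ℝ)
    (h1 : ∀ i j k l, Φ4 i j k l = -Φ4 j i k l)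
    (h2 : ∀ i j k l, Φ4 i j k l = -Φ4 i j l k)
    (ΦS : Fin 2 → Fin 2 → ℝ)
    (hΦS : ∀ i k, ΦS i k = -(1/2) * ∑ j, Φ4 i j k j)
    (φ : ℝ) (hφ : φ = -(1/2) * ∑ i, ∑ j, Φ4 i j i j) :
    ∀ i k, ΦS i k = (1/2) * φ * δ i k := by
  have first_diag (i k l) : Φ4 i i k l = 0 := by linarith [h1 i i k l]
  have second_diag (i j k) : Φ4 i j k k = 0 := by linarith [h2 i j k k]
  have swap_both : Φ4 1 0 1 0 = Φ4 0 1 0 1 := by linarith [h1 1 0 1 0, h2 0 1 1 0]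
  intro i k
  rw [hΦS, hφ]
  fin_cases i <;> fin_cases k <;>
    simp [δ, Fin.sum_univ_two, first_diag, second_diag, swap_both] <;> ring
end

section
/- Let Ψ : Fin 2 → Fin 2 → Fin 2 → ℝ satisfy Ψ i j k = −Ψ i k j for all i, j, k, and set Ψv j := ∑ i, Ψ i j i. Then Ψ i j k = δ i k * Ψv j − δ i j * Ψv k for all i, j, k. (This is the 4-dimensional identity Ψ_{ijk} = −2δ_{i[j}Ψ_{k]}: when d = 4 the tensor Ψ_{ijk} is completely determined by its trace Ψ_i.) -/
/-- In n = 2 (spacetime dimension d = 4), a tensor `Ψ` antisymmetric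
in its last two indices is completely determined by its trace `Ψv`:
`Ψ i j k = δ i k * Ψv j − δ i j * Ψv k`. -/
theorem psi_determined_by_trace_dim4
    (Ψ : Fin 2 → Fin 2 → Fin 2 → ℝ)
    (hanti : ∀ i j k, Ψ i j k = -Ψ i k j)
    (Ψv : Fin 2 → ℝ) (hΨv : ∀ j, Ψv j = ∑ i, Ψ i j i) :
    ∀ i j k, Ψ i j k = δ i k * Ψv j - δ i j * Ψv k := by
  have hdiag (i j : Fin 2) : Ψ i j j = 0 := by linarith [hanti i j j]
  have hswap (i : Fin 2) : Ψ i 1 0 = -Ψ i 0 1 := hanti i 1 0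
  intro i j k
  fin_cases i <;> fin_cases j <;> fin_cases k <;>
    simp [δ, hΨv, Fin.sum_univ_two, hdiag, hswap]
end

section
/- Let Ψ : Fin 2 → Fin 2 → Fin 2 → ℝ satisfy Ψ i j k = −Ψ i k j for all i, j, k, and set Ψv j := ∑ i, Ψ i j i. Then for all i, j, k: (1/2)*(Ψ i j k + Ψ j i k) − (1/2)*(Ψv i * δ j k + Ψv j * δ i k) + δ i j * Ψv k = 0. (This is the vanishing, when d = 4, of the combination Ψ_{(ij)k} − Ψ_{(i}δ_{j)k} + (2/(d−2))δ_{ij}Ψ_k that obstructs decoupling of gravitational perturbations in d > 4.) -/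
/-- In n = 2 (spacetime dimension d = 4), the combination
`Ψ_{(ij)k} − Ψ_{(i}δ_{j)k} + δ_{ij}Ψ_k` (which obstructs decoupling of
gravitational perturbations when d > 4) vanishes identically. -/
theorem obstruction_vanishes_dim4
    (Ψ : Fin 2 → Fin 2 → Fin 2 → ℝ)
    (hanti : ∀ i j k, Ψ i j k = -Ψ i k j)
    (Ψv : Fin 2 → ℝ) (hΨv : ∀ j, Ψv j = ∑ i, Ψ i j i) :
    ∀ i j k, (1/2) * (Ψ i j k + Ψ j i k) - (1/2) * (Ψv i * δ j k + Ψv j * δ i k)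
      + δ i j * Ψv k = 0 := by
  have h00 (i : Fin 2) : Ψ i 0 0 = 0 := by linarith [hanti i 0 0]
  have h11 (i : Fin 2) : Ψ i 1 1 = 0 := by linarith [hanti i 1 1]
  have h10 (i : Fin 2) : Ψ i 1 0 = -Ψ i 0 1 := hanti i 1 0
  intro i j k
  fin_cases i <;> fin_cases j <;> fin_cases k <;>
    simp [δ, hΨv, Fin.sum_univ_two, h00, h11, h10] <;> ring
end
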